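/- arXiv:2405.20599 — 3 statements merged into one kernel-verified Lean document; each statement's English description precedes it below -/
import Mathlib

section
/- Let G = (V,E) be a finite simple graph, let I ⊆ V be an independent set, and let C = V \ I. Let (V1', V2') be any cut of G, and set C1 = V1' ∩ C and C2 = V2' ∩ C. Define I1 = {v ∈ I : |N(v) ∩ C2| ≥ |N(v) ∩ C1|} and I2 = I \ I1. Then the size of the cut (C1 ∪ I1, C2 ∪ I2) is at least the size of the cut (V1', V2'), i.e. |E(C1 ∪ I1, C2 ∪ I2)| ≥ |E(V1', V2')|. -/
open Finset

/-- The size of the cut `(A, B)`: the number of edges with one endpoint in `A`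
and the other in `B` (for disjoint `A`, `B`). -/
def cutSize {V : Type*} [Fintype V] [DecidableEq V] (G : SimpleGraph V) [DecidableRel G.Adj]
    (A B : Finset V) : ℕ :=
  ((A ×ˢ B).filter fun p => G.Adj p.1 p.2).card

theorem cutSize_eq_sum {V : Type*} [Fintype V] [DecidableEq V] (G : SimpleGraph V)
    [DecidableRel G.Adj] (A B : Finset V) :
    cutSize G A B = ∑ a ∈ A, ∑ b ∈ B, if G.Adj a b then 1 else 0 := by
  rw [cutSize, Finset.card_filter, Finset.sum_product]

theorem nbr_card {V : Type*} [Fintype V] [DecidableEq V] (G : SimpleGraph V)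
    [DecidableRel G.Adj] (v : V) (B : Finset V) :
    (∑ b ∈ B, if G.Adj v b then 1 else 0) = (G.neighborFinset v ∩ B).card := by
  rw [← Finset.card_filter]
  congr 1
  ext x
  simp [and_comm]

theorem cut_decomp {V : Type*} [Fintype V] [DecidableEq V] (G : SimpleGraph V)
    [DecidableRel G.Adj] (I : Finset V) (hI : ∀ u ∈ I, ∀ v ∈ I, ¬ G.Adj u v)
    (C1 C2 J1 J2 : Finset V) (h1 : Disjoint C1 I) (h2 : Disjoint C2 I)
    (hJ1 : J1 ⊆ I) (hJ2 : J2 = I \ J1) :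
    cutSize G (C1 ∪ J1) (C2 ∪ J2) = cutSize G C1 C2 +
      ∑ v ∈ I, if v ∈ J1 then (G.neighborFinset v ∩ C2).card
        else (G.neighborFinset v ∩ C1).card := by
  have hJ2' : J2 ⊆ I := by rw [hJ2]; exact Finset.sdiff_subset
  have d1 : Disjoint C1 J1 := h1.mono_right hJ1
  have d2 : Disjoint C2 J2 := h2.mono_right hJ2'
  have z : (∑ a ∈ J1, ∑ b ∈ J2, if G.Adj a b then 1 else 0) = 0 :=
    Finset.sum_eq_zero fun a ha => Finset.sum_eq_zero fun b hb =>
      if_neg (hI a (hJ1 ha) b (hJ2' hb))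
  have e1 : (∑ a ∈ J1, ∑ b ∈ C2, if G.Adj a b then 1 else 0)
      = ∑ v ∈ J1, (G.neighborFinset v ∩ C2).card :=
    Finset.sum_congr rfl fun v _ => nbr_card G v C2
  have e2 : (∑ a ∈ C1, ∑ b ∈ J2, if G.Adj a b then 1 else 0)
      = ∑ v ∈ J2, (G.neighborFinset v ∩ C1).card := by
    rw [Finset.sum_comm]
    refine Finset.sum_congr rfl fun v _ => ?_
    rw [← nbr_card]
    simp only [G.adj_comm]
  have e3 : (∑ v ∈ I, if v ∈ J1 then (G.neighborFinset v ∩ C2).card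
        else (G.neighborFinset v ∩ C1).card) =
      ∑ v ∈ J1, (G.neighborFinset v ∩ C2).card + ∑ v ∈ J2, (G.neighborFinset v ∩ C1).card := by
    rw [Finset.sum_ite]
    congr 2
    · ext x
      simp only [Finset.mem_filter]
      exact ⟨fun h => h.2, fun h => ⟨hJ1 h, h⟩⟩
    · ext x
      simp [hJ2]
  rw [e3, cutSize_eq_sum, cutSize_eq_sum, Finset.sum_union d1]
  simp only [Finset.sum_union d2, Finset.sum_add_distrib]
  rw [z, e1, e2]
  ring

theorem stmt_0 {V : Type*} [Fintype V] [DecidableEq V] (G : SimpleGraph V) [DecidableRel G.Adj]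
    (I : Finset V) (hI : ∀ u ∈ I, ∀ v ∈ I, ¬ G.Adj u v)
    (C : Finset V) (hC : C = Finset.univ \ I)
    (V1' V2' : Finset V) (hcut : V1' ∪ V2' = Finset.univ) (hdisj : Disjoint V1' V2')
    (C1 C2 I1 I2 : Finset V)
    (hC1 : C1 = V1' ∩ C) (hC2 : C2 = V2' ∩ C)
    (hI1 : I1 = I.filter fun v =>
      (G.neighborFinset v ∩ C1).card ≤ (G.neighborFinset v ∩ C2).card)
    (hI2 : I2 = I \ I1) :
    cutSize G V1' V2' ≤ cutSize G (C1 ∪ I1) (C2 ∪ I2) := by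
  have m : ∀ x, x ∈ V1' ∨ x ∈ V2' := fun x => by
    rw [← Finset.mem_union, hcut]; exact Finset.mem_univ x
  have nd : ∀ x, x ∈ V1' → x ∉ V2' := fun x hx => Finset.disjoint_left.mp hdisj hx
  have h1 : Disjoint C1 I := by
    rw [Finset.disjoint_left]; intro x hx; simp [hC1, hC] at hx; exact hx.2
  have h2 : Disjoint C2 I := by
    rw [Finset.disjoint_left]; intro x hx; simp [hC2, hC] at hx; exact hx.2
  have hV1 : V1' = C1 ∪ (V1' ∩ I) := by
    ext x; simp [hC1, hC]; tauto
  have hV2 : V2' = C2 ∪ (I \ (V1' ∩ I)) := by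
    ext x; have := m x; have := nd x; simp [hC2, hC]; tauto
  have key : cutSize G V1' V2' = cutSize G (C1 ∪ (V1' ∩ I)) (C2 ∪ (I \ (V1' ∩ I))) := by
    rw [← hV1, ← hV2]
  rw [key, cut_decomp G I hI C1 C2 _ _ h1 h2 Finset.inter_subset_right rfl,
    cut_decomp G I hI C1 C2 I1 I2 h1 h2 (by rw [hI1]; exact Finset.filter_subset _ _) hI2]
  refine Nat.add_le_add_left (Finset.sum_le_sum fun v hv => ?_) _
  have hm : v ∈ I1 ↔ (G.neighborFinset v ∩ C1).card ≤ (G.neighborFinset v ∩ C2).card := by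
    rw [hI1, Finset.mem_filter]; exact ⟨fun h => h.2, fun h => ⟨hv, h⟩⟩
  by_cases h : v ∈ I1
  · rw [if_pos h]
    have := hm.mp h
    split_ifs <;> omega
  · rw [if_neg h]
    have := mt hm.mpr h
    split_ifs <;> omega
end

section
/- Let G = (V,E) be a finite simple graph and let I ⊆ V be an independent set, with C = V \ I. Then the maximum size of a cut of G equals the maximum, over all subsets C1 ⊆ C (with C2 = C \ C1), of the quantity |E(C1, C2)| + Σ_{v ∈ I} max(|N(v) ∩ C1|, |N(v) ∩ C2|), where |E(C1, C2)| denotes the number of edges with one endpoint in C1 and the other in C2. -/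
open Finset

lemma cutSize_eq_left {V : Type*} [Fintype V] [DecidableEq V] (G : SimpleGraph V)
    [DecidableRel G.Adj] (A B : Finset V) :
    cutSize G A B = ∑ v ∈ A, (G.neighborFinset v ∩ B).card := by
  unfold cutSize
  rw [Finset.card_filter, Finset.sum_product]
  refine Finset.sum_congr rfl fun v _ => ?_
  rw [← Finset.card_filter]
  congr 1
  ext w
  simp [and_comm]

lemma cutSize_comm {V : Type*} [Fintype V] [DecidableEq V] (G : SimpleGraph V)
    [DecidableRel G.Adj] (A B : Finset V) : cutSize G A B = cutSize G B A := by
  unfold cutSize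
  rw [Finset.card_filter, Finset.card_filter, Finset.sum_product, Finset.sum_product_right]
  simp [G.adj_comm]

lemma cutSize_union_left {V : Type*} [Fintype V] [DecidableEq V] (G : SimpleGraph V)
    [DecidableRel G.Adj] (A J B : Finset V) (h : Disjoint A J) :
    cutSize G (A ∪ J) B = cutSize G A B + cutSize G J B := by
  simp only [cutSize_eq_left, Finset.sum_union h]

lemma cutSize_split {V : Type*} [Fintype V] [DecidableEq V] (G : SimpleGraph V)
    [DecidableRel G.Adj] (I : Finset V) (hI : ∀ u ∈ I, ∀ v ∈ I, ¬ G.Adj u v)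
    (C : Finset V) (hC : C = Finset.univ \ I) (W : Finset V) :
    cutSize G W Wᶜ = cutSize G (W ∩ C) (C \ (W ∩ C)) +
      ∑ v ∈ I, if v ∈ W then (G.neighborFinset v ∩ (C \ (W ∩ C))).card
        else (G.neighborFinset v ∩ (W ∩ C)).card := by
  have h1 : W = (W ∩ C) ∪ (I.filter (· ∈ W)) := by
    ext x; simp [hC]; tauto
  have h2 : Wᶜ = (C \ (W ∩ C)) ∪ (I.filter (· ∉ W)) := by
    ext x; simp [hC]; tauto
  have d1 : Disjoint (W ∩ C) (I.filter (· ∈ W)) := by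
    rw [Finset.disjoint_left]; intro x; simp [hC]; tauto
  have d2 : Disjoint (C \ (W ∩ C)) (I.filter (· ∉ W)) := by
    rw [Finset.disjoint_left]; intro x; simp [hC]; tauto
  have h0 : cutSize G (I.filter (· ∉ W)) (I.filter (· ∈ W)) = 0 := by
    unfold cutSize
    rw [Finset.card_eq_zero, Finset.filter_eq_empty_iff]
    intro p hp
    simp only [Finset.mem_product, Finset.mem_filter] at hp
    exact hI _ hp.1.1 _ hp.2.1
  have e : cutSize G W Wᶜ = cutSize G ((W ∩ C) ∪ (I.filter (· ∈ W)))
      ((C \ (W ∩ C)) ∪ (I.filter (· ∉ W))) := by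
    rw [← h1, ← h2]
  rw [e, cutSize_comm, cutSize_union_left _ _ _ _ d2, cutSize_comm,
    cutSize_union_left _ _ _ _ d1, cutSize_comm G (I.filter (· ∉ W)),
    cutSize_union_left _ _ _ _ d1, cutSize_comm G (I.filter (· ∈ W)) (I.filter (· ∉ W)), h0,
    cutSize_comm G (W ∩ C) (I.filter (· ∉ W)), Finset.sum_ite,
    cutSize_eq_left G (I.filter (· ∈ W)), cutSize_eq_left G (I.filter (· ∉ W))]
  ring

theorem stmt_1 {V : Type*} [Fintype V] [DecidableEq V] (G : SimpleGraph V) [DecidableRel G.Adj]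
    (I : Finset V) (hI : ∀ u ∈ I, ∀ v ∈ I, ¬ G.Adj u v)
    (C : Finset V) (hC : C = Finset.univ \ I) :
    (Finset.univ.sup fun V1 : Finset V => cutSize G V1 V1ᶜ) =
      C.powerset.sup fun C1 =>
        cutSize G C1 (C \ C1) +
          ∑ v ∈ I, max (G.neighborFinset v ∩ C1).card
            (G.neighborFinset v ∩ (C \ C1)).card := by
  apply le_antisymm
  · refine Finset.sup_le fun W _ => ?_
    rw [cutSize_split G I hI C hC W]
    refine le_trans ?_ (Finset.le_sup (b := W ∩ C)
      (Finset.mem_powerset.2 Finset.inter_subset_right))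
    refine Nat.add_le_add_left (Finset.sum_le_sum fun v _ => ?_) _
    split_ifs
    · exact le_max_right _ _
    · exact le_max_left _ _
  · refine Finset.sup_le fun A hA => ?_
    rw [Finset.mem_powerset] at hA
    let W : Finset V := A ∪ I.filter fun v =>
      (G.neighborFinset v ∩ A).card ≤ (G.neighborFinset v ∩ (C \ A)).card
    have hW : W ∩ C = A := by
      ext x
      have := @hA x
      simp only [W, hC, Finset.mem_inter, Finset.mem_union, Finset.mem_filter,
        Finset.mem_sdiff, Finset.mem_univ, true_and] at this ⊢
      tauto
    refine le_trans (le_of_eq ?_) (Finset.le_sup (b := W) (Finset.mem_univ _))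
    rw [cutSize_split G I hI C hC W, hW]
    congr 1
    refine Finset.sum_congr rfl fun v hv => ?_
    have hvA : v ∉ A := fun h => by
      have := hA h
      simp [hC, hv] at this
    have hvW : v ∈ W ↔
        (G.neighborFinset v ∩ A).card ≤ (G.neighborFinset v ∩ (C \ A)).card := by
      simp only [W, Finset.mem_union, Finset.mem_filter, hvA, hv, false_or, true_and]
    by_cases h : v ∈ W
    · rw [if_pos h, max_eq_right (hvW.1 h)]
    · rw [if_neg h, max_eq_left (le_of_not_ge fun h' => h (hvW.2 h'))]
end

section
/- Let G = (V,E) be a finite simple graph and let C ⊆ V be a clique, with I = V \ C. Then there exists a maximum cut (V1, V2) of G such that, writing I1 = V1 ∩ I and I2 = V2 ∩ I, every u ∈ V1 ∩ C and w ∈ V2 ∩ C satisfy |N(u) ∩ I2| − |N(u) ∩ I1| ≥ |N(w) ∩ I2| − |N(w) ∩ I1| (differences computed in ℤ). -/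
open Finset

/-- Size of a cut after adding one vertex to each side. -/
theorem cutSize_insert {V : Type*} [Fintype V] [DecidableEq V] (G : SimpleGraph V)
    [DecidableRel G.Adj] (A B : Finset V) (a b : V) (ha : a ∉ A) (hb : b ∉ B) :
    cutSize G (insert a A) (insert b B) = cutSize G A B + (B.filter (G.Adj a)).card
      + (A.filter (G.Adj b)).card + (if G.Adj a b then 1 else 0) := by
  simp only [cutSize, Finset.card_filter, Finset.sum_product, Finset.sum_insert ha,
    Finset.sum_insert hb, Finset.sum_add_distrib, G.adj_comm b]
  ring

/-- Neighbours of a clique vertex, split into those outside and inside the clique. -/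
theorem deg_split {V : Type*} [Fintype V] [DecidableEq V] (G : SimpleGraph V)
    [DecidableRel G.Adj] (C : Finset V) (hC : ∀ u ∈ C, ∀ v ∈ C, u ≠ v → G.Adj u v)
    (x : V) (hx : x ∈ C) (B : Finset V) (hB : x ∉ B) :
    (B.filter (G.Adj x)).card
      = (G.neighborFinset x ∩ (B ∩ (Finset.univ \ C))).card + (B ∩ C).card := by
  rw [← Finset.card_union_of_disjoint]
  · congr 1
    ext y
    have := hC x hx y
    simp only [Finset.mem_filter, Finset.mem_union, Finset.mem_inter, Finset.mem_sdiff,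
      Finset.mem_univ, SimpleGraph.mem_neighborFinset]
    grind
  · rw [Finset.disjoint_left]
    intro y h1 h2
    simp only [Finset.mem_inter, Finset.mem_sdiff] at h1 h2
    tauto

theorem stmt_7 {V : Type*} [Fintype V] [DecidableEq V] (G : SimpleGraph V) [DecidableRel G.Adj]
    (C : Finset V) (hC : ∀ u ∈ C, ∀ v ∈ C, u ≠ v → G.Adj u v)
    (I : Finset V) (hI : I = Finset.univ \ C) :
    ∃ V1 V2 : Finset V, V1 ∪ V2 = Finset.univ ∧ Disjoint V1 V2 ∧
      (∀ W1 W2 : Finset V, W1 ∪ W2 = Finset.univ → Disjoint W1 W2 →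
        cutSize G W1 W2 ≤ cutSize G V1 V2) ∧
      (∀ u ∈ V1 ∩ C, ∀ w ∈ V2 ∩ C,
        ((G.neighborFinset w ∩ (V2 ∩ I)).card : ℤ)
            - (G.neighborFinset w ∩ (V1 ∩ I)).card ≤
          ((G.neighborFinset u ∩ (V2 ∩ I)).card : ℤ)
            - (G.neighborFinset u ∩ (V1 ∩ I)).card) := by
  classical
  let S : Finset (Finset V × Finset V) :=
    Finset.univ.filter fun p => p.1 ∪ p.2 = Finset.univ ∧ Disjoint p.1 p.2
  have hS : S.Nonempty := ⟨(Finset.univ, ∅), by simp [S]⟩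
  obtain ⟨⟨V1, V2⟩, hm, hmax⟩ := Finset.exists_max_image S (fun p => cutSize G p.1 p.2) hS
  have hm' : V1 ∪ V2 = Finset.univ ∧ Disjoint V1 V2 := by simpa [S] using hm
  obtain ⟨hU, hD⟩ := hm'
  have hM : ∀ W1 W2 : Finset V, W1 ∪ W2 = Finset.univ → Disjoint W1 W2 →
      cutSize G W1 W2 ≤ cutSize G V1 V2 := by
    intro W1 W2 h1 h2
    exact hmax (W1, W2) (by simp [S, h1, h2])
  refine ⟨V1, V2, hU, hD, hM, ?_⟩
  intro u hu w hw
  rw [Finset.mem_inter] at hu hw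
  obtain ⟨hu1, huC⟩ := hu
  obtain ⟨hw2, hwC⟩ := hw
  have hu2 : u ∉ V2 := Finset.disjoint_left.mp hD hu1
  have hw1 : w ∉ V1 := Finset.disjoint_right.mp hD hw2
  have huw : u ≠ w := fun h => hu2 (h ▸ hw2)
  have key := hM (insert w (V1.erase u)) (insert u (V2.erase w))
    (by
      ext x
      have := Finset.ext_iff.mp hU x
      simp only [Finset.mem_union, Finset.mem_univ, iff_true] at this
      simp only [Finset.mem_union, Finset.mem_insert, Finset.mem_erase, Finset.mem_univ, iff_true]
      tauto)
    (by
      rw [Finset.disjoint_left] at hD ⊢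
      intro x hx hx'
      have := @hD x
      simp only [Finset.mem_insert, Finset.mem_erase] at hx hx'
      grind)
  have e := cutSize_insert G (V1.erase u) (V2.erase w) u w (by simp) (by simp)
  rw [Finset.insert_erase hu1, Finset.insert_erase hw2] at e
  rw [e, cutSize_insert G (V1.erase u) (V2.erase w) w u (by simp [hw1]) (by simp [hu2])] at key
  simp only [G.adj_comm w u] at key
  subst hI
  rw [deg_split G C hC u huC (V1.erase u) (by simp),
    deg_split G C hC w hwC (V1.erase u) (by simp [hw1]),
    deg_split G C hC u huC (V2.erase w) (by simp [hu2]),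
    deg_split G C hC w hwC (V2.erase w) (by simp)] at key
  have e1 : V1.erase u ∩ (Finset.univ \ C) = V1 ∩ (Finset.univ \ C) := by
    ext x; simp only [Finset.mem_inter, Finset.mem_erase, Finset.mem_sdiff]; grind
  have e2 : V2.erase w ∩ (Finset.univ \ C) = V2 ∩ (Finset.univ \ C) := by
    ext x; simp only [Finset.mem_inter, Finset.mem_erase, Finset.mem_sdiff]; grind
  rw [e1, e2] at key
  omega
end
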